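/- arXiv:2602.23381 — 3 statements merged into one kernel-verified Lean document; each statement's English description precedes it below -/
import Mathlib

section
/- Let X be a topological space, let 𝒜 ⊆ C(X;ℝ) be a family of continuous real-valued functions on X having the D-property, let σ : ℝ → ℝ satisfy the univariate universal approximation property, and let m ≥ 1 be an integer. Then for every compact set K ⊆ X, every continuous function g : K → ℝ^m, and every ε > 0, there exist, for each k ∈ {1,…,m}, a finite index set, functions f_{k,i} ∈ 𝒜, and real numbers c_{k,i}, w_{k,i}, θ_{k,i}, such that the function H : X → ℝ^m whose k-th component is H_k(x) = Σ_i c_{k,i} σ(w_{k,i} f_{k,i}(x) − θ_{k,i}) satisfies sup_{x ∈ K} ‖g(x) − H(x)‖ < ε, where ‖·‖ is the Euclidean norm on ℝ^m. -/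
open scoped BigOperators

/-- σ satisfies the univariate universal approximation property. -/
def UnivariateUAP (σ : ℝ → ℝ) : Prop :=
  ∀ (a b : ℝ) (u : ℝ → ℝ), ContinuousOn u (Set.Icc a b) → ∀ ε : ℝ, 0 < ε →
    ∃ (N : ℕ) (c w θ : Fin N → ℝ),
      ∀ t ∈ Set.Icc a b, |u t - ∑ j, c j * σ (w j * t - θ j)| < ε

/-- A family 𝒜 ⊆ C(X;ℝ) has the D-property. -/
def DProperty {X : Type*} [TopologicalSpace X] (A : Set C(X, ℝ)) : Prop :=
  ∀ (K : Set X), IsCompact K → ∀ (g : C(K, ℝ)) (ε : ℝ), 0 < ε →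
    ∃ (M : ℕ) (f : Fin M → C(X, ℝ)) (u : Fin M → C(ℝ, ℝ)),
      (∀ i, f i ∈ A) ∧
      ∀ x : K, |g x - ∑ i, u i (f i (x : X))| < ε

/-- A family with the D-property, composed with translates and dilates of an activation function
having the univariate universal approximation property, approximates every continuous real-valued
function on a compact set. -/
theorem DProperty.exists_shallow_approx {X : Type*} [TopologicalSpace X] {A : Set C(X, ℝ)}
    (hA : DProperty A) {σ : ℝ → ℝ} (hσ : UnivariateUAP σ) {K : Set X} (hK : IsCompact K)
    (g : C(K, ℝ)) {ε : ℝ} (hε : 0 < ε) :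
    ∃ (N : ℕ) (f : Fin N → C(X, ℝ)) (c w θ : Fin N → ℝ), (∀ i, f i ∈ A) ∧
      ∀ x : K, |g x - ∑ i, c i * σ (w i * f i (x : X) - θ i)| < ε := by
  obtain ⟨M, f, u, hf, hgu⟩ := hA K hK g (ε / 2) (half_pos hε)
  have hδ : 0 < ε / 2 / (M + 1) := by positivity
  have approx_on_range (i : Fin M) : ∃ (N : ℕ) (c w θ : Fin N → ℝ),
      ∀ x ∈ K, |u i (f i x) - ∑ j, c j * σ (w j * f i x - θ j)| < ε / 2 / (M + 1) := by
    have hbdd := (hK.image (f i).continuous).isBounded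
    obtain ⟨N, c, w, θ, h⟩ :=
      hσ (sInf (f i '' K)) (sSup (f i '' K)) (u i) (u i).continuous.continuousOn _ hδ
    exact ⟨N, c, w, θ, fun x hx => h _ (hbdd.subset_Icc_sInf_sSup (Set.mem_image_of_mem _ hx))⟩
  choose N c w θ h using approx_on_range
  let e : Fin (Fintype.card (Σ i, Fin (N i))) ≃ Σ i, Fin (N i) := (Fintype.equivFin _).symm
  refine ⟨_, fun j => f (e j).1, fun j => c _ (e j).2, fun j => w _ (e j).2,
    fun j => θ _ (e j).2, fun j => hf _, fun x => ?_⟩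
  rw [e.sum_comp fun p : Σ i, Fin (N i) => c p.1 p.2 * σ (w p.1 p.2 * f p.1 (x : X) - θ p.1 p.2),
    Fintype.sum_sigma]
  have hsum : |∑ i, u i (f i (x : X)) -
      ∑ i, ∑ j, c i j * σ (w i j * f i (x : X) - θ i j)| ≤ ε / 2 := by
    rw [← Finset.sum_sub_distrib]
    calc _ ≤ ∑ i, |u i (f i (x : X)) - ∑ j, c i j * σ (w i j * f i (x : X) - θ i j)| :=
          Finset.abs_sum_le_sum_abs _ _
      _ ≤ ∑ _i : Fin M, ε / 2 / (M + 1) := Finset.sum_le_sum fun i _ => (h i x x.2).le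
      _ = M * (ε / 2 / (M + 1)) := by simp
      _ ≤ (M + 1) * (ε / 2 / (M + 1)) := by gcongr; linarith
      _ = ε / 2 := by field_simp
  calc _ ≤ _ := abs_sub_le _ (∑ i, u i (f i (x : X))) _
    _ < ε / 2 + ε / 2 := add_lt_add_of_lt_of_le (hgu x) hsum
    _ = ε := add_halves ε

theorem EuclideanSpace.norm_lt_of_forall_abs_lt {ι : Type*} [Fintype ι] [Nonempty ι]
    {v : EuclideanSpace ℝ ι} {ε : ℝ} (h : ∀ i, |v i| < ε / Fintype.card ι) :
    ‖v‖ < ε := by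
  classical
  have hcard : (0 : ℝ) < Fintype.card ι := by exact_mod_cast Fintype.card_pos
  calc ‖v‖ = ‖∑ i, EuclideanSpace.single i (v i)‖ := by
        congr 1
        ext j
        simp [Finset.sum_apply, Pi.single_apply]
    _ ≤ ∑ i, |v i| := (norm_sum_le _ _).trans_eq (by simp)
    _ < ∑ _i : ι, ε / Fintype.card ι :=
        Finset.sum_lt_sum_of_nonempty Finset.univ_nonempty fun i _ => h i
    _ = ε := by simp; field_simp

theorem stmt0 {X : Type*} [TopologicalSpace X]
    (A : Set C(X, ℝ)) (hA : DProperty A)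
    (σ : ℝ → ℝ) (hσ : UnivariateUAP σ)
    (m : ℕ) (hm : 1 ≤ m)
    (K : Set X) (hK : IsCompact K)
    (g : C(K, EuclideanSpace ℝ (Fin m)))
    (ε : ℝ) (hε : 0 < ε) :
    ∃ (N : Fin m → ℕ) (f : ∀ k : Fin m, Fin (N k) → C(X, ℝ))
      (c w θ : ∀ k : Fin m, Fin (N k) → ℝ),
      (∀ k i, f k i ∈ A) ∧
      ∀ x : K,
        ‖g x - (EuclideanSpace.equiv (Fin m) ℝ).symm
            (fun k => ∑ i, c k i * σ (w k i * f k i (x : X) - θ k i))‖ < ε := by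
  have : Nonempty (Fin m) := ⟨⟨0, hm⟩⟩
  have hδ : 0 < ε / Fintype.card (Fin m) := div_pos hε (by exact_mod_cast Fintype.card_pos)
  choose N f c w θ hf h using fun k : Fin m =>
    hA.exists_shallow_approx hσ hK ⟨fun x => g x k, by fun_prop⟩ hδ
  exact ⟨N, f, c, w, θ, hf, fun x =>
    EuclideanSpace.norm_lt_of_forall_abs_lt fun k => h k x⟩
end

section
/- Let X be a topological space, K ⊆ X a compact set, m ≥ 1 an integer, and F = (f_1,…,f_n) : X → ℝ^n a continuous map such that the set {u ∘ F|_K : u ∈ C(ℝ^n;ℝ^m)} is dense in C(K;ℝ^m) with respect to the uniform norm on K. Assume σ : ℝ → ℝ is continuous, is not an affine function, and there exist t_0 ∈ ℝ and an open neighborhood U of t_0 such that σ is differentiable on U, σ' is continuous at t_0, and σ'(t_0) ≠ 0. Then for every continuous function g : K → ℝ^m and every ε > 0 there exists a deep feedforward network Φ : ℝ^n → ℝ^m with activation σ and width at most n + m + 2 such that sup_{x ∈ K} ‖g(x) − Φ(F(x))‖ < ε, where ‖·‖ is the Euclidean norm on ℝ^m. -/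
open scoped BigOperators

/-- Componentwise application of the activation function. -/
def applyAct (σ : ℝ → ℝ) {d : ℕ} (y : Fin d → ℝ) : Fin d → ℝ := fun i => σ (y i)

/-- `IsHiddenStack σ k n d H` means that `H : ℝⁿ → ℝᵈ` has the form
`σ ∘ T_l ∘ σ ∘ ⋯ ∘ σ ∘ T_0` where each `T_j` is affine and every hidden layer
has width at most `k`. -/
inductive IsHiddenStack (σ : ℝ → ℝ) (k n : ℕ) :
    (d : ℕ) → ((Fin n → ℝ) → (Fin d → ℝ)) → Prop
  | base {d : ℕ} (hd : d ≤ k) (A : Matrix (Fin d) (Fin n) ℝ) (b : Fin d → ℝ) :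
      IsHiddenStack σ k n d (fun x => applyAct σ (A.mulVec x - b))
  | step {d e : ℕ} (he : e ≤ k) {H : (Fin n → ℝ) → (Fin d → ℝ)}
      (hH : IsHiddenStack σ k n d H) (A : Matrix (Fin e) (Fin d) ℝ) (b : Fin e → ℝ) :
      IsHiddenStack σ k n e (fun x => applyAct σ (A.mulVec (H x) - b))

/-- `Φ : ℝⁿ → ℝᵐ` is a deep feedforward network with activation `σ` and width at
most `k`: a composition `T_{l+1} ∘ σ ∘ T_l ∘ σ ∘ ⋯ ∘ σ ∘ T_0` of affine maps and
componentwise activations, with all hidden widths `≤ k`. -/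
def IsDeepNet (σ : ℝ → ℝ) (k n m : ℕ) (Φ : (Fin n → ℝ) → (Fin m → ℝ)) : Prop :=
  ∃ (d : ℕ) (H : (Fin n → ℝ) → (Fin d → ℝ)),
    IsHiddenStack σ k n d H ∧
    ∃ (A : Matrix (Fin m) (Fin d) ℝ) (b : Fin m → ℝ),
      Φ = fun x => A.mulVec (H x) - b


open Set Filter Topology

/-! ### Approximation in the compact-open topology -/

theorem ContinuousMap.mem_closure_iff_forall_isCompact {α β : Type*} [TopologicalSpace α]
    [PseudoMetricSpace β] {S : Set C(α, β)} {f : C(α, β)} :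
    f ∈ closure S ↔ ∀ K : Set α, IsCompact K → ∀ ε : ℝ, 0 < ε →
      ∃ g ∈ S, ∀ x ∈ K, dist (f x) (g x) < ε := by
  rw [mem_closure_iff_nhds_basis
    (nhds_basis_uniformity Metric.uniformity_basis_dist.compactConvergenceUniformity)]
  simp only [Prod.forall, and_imp, mem_ofPred_eq]
  refine forall_congr' fun K => ⟨fun h hK ε hε => ?_, fun h ε hK hε => ?_⟩
  · obtain ⟨g, hg, h⟩ := h ε hK hε
    exact ⟨g, hg, fun x hx => by simpa [dist_comm] using h x hx⟩
  · obtain ⟨g, hg, h⟩ := h hK ε hε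
    exact ⟨g, hg, fun x hx => by simpa [dist_comm] using h x hx⟩

theorem IsClosed.mem_of_continuous_of_forall_ne {Y : Type*} [TopologicalSpace Y] {S : Set Y}
    (hS : IsClosed S) {c : ℝ → Y} (hc : Continuous c) (h : ∀ t, t ≠ 0 → c t ∈ S) : c 0 ∈ S :=
  hS.mem_of_tendsto ((hc.tendsto 0).mono_left nhdsWithin_le_nhds)
    (eventually_mem_nhdsWithin.mono h : ∀ᶠ t in 𝓝[≠] (0 : ℝ), c t ∈ S)

theorem continuous_dslope {f : ℝ → ℝ} {a : ℝ} (hf : Continuous f) (ha : DifferentiableAt ℝ f a) :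
    Continuous (dslope f a) := by
  rw [← continuousOn_univ, continuousOn_dslope univ_mem]
  exact ⟨hf.continuousOn, ha⟩

/-! ### Composition of deep networks -/

section Networks

variable {σ : ℝ → ℝ} {K : ℕ}

theorem IsDeepNet.affine_comp {a b c : ℕ} {f : (Fin a → ℝ) → (Fin b → ℝ)}
    (hf : IsDeepNet σ K a b f) (T : (Fin b → ℝ) →ₗ[ℝ] (Fin c → ℝ)) (v : Fin c → ℝ) :
    IsDeepNet σ K a c (fun x => T (f x) + v) := by
  obtain ⟨d, H, hH, A, b, rfl⟩ := hf
  refine ⟨d, H, hH, LinearMap.toMatrix' T * A, T b - v, ?_⟩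
  funext x
  rw [map_sub, ← Matrix.mulVec_mulVec, LinearMap.toMatrix'_mulVec]
  abel

theorem IsHiddenStack.comp_affine {a b d : ℕ} {H : (Fin b → ℝ) → (Fin d → ℝ)}
    (hH : IsHiddenStack σ K b d H) (T : (Fin a → ℝ) →ₗ[ℝ] (Fin b → ℝ)) (v : Fin b → ℝ) :
    IsHiddenStack σ K a d (fun x => H (T x + v)) := by
  induction hH with
  | base hd A w =>
    convert IsHiddenStack.base hd (A * LinearMap.toMatrix' T) (w - A.mulVec v) using 3
    rw [← Matrix.mulVec_mulVec, LinearMap.toMatrix'_mulVec, Matrix.mulVec_add]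
    abel
  | step he _ A w ih => exact IsHiddenStack.step he ih A w

theorem IsDeepNet.comp_affine {a b c : ℕ} {f : (Fin b → ℝ) → (Fin c → ℝ)}
    (hf : IsDeepNet σ K b c f) (T : (Fin a → ℝ) →ₗ[ℝ] (Fin b → ℝ)) (v : Fin b → ℝ) :
    IsDeepNet σ K a c (fun x => f (T x + v)) := by
  obtain ⟨d, H, hH, A, b, rfl⟩ := hf
  exact ⟨d, _, hH.comp_affine T v, A, b, rfl⟩

theorem IsHiddenStack.comp_deepNet {a b d : ℕ} {H : (Fin b → ℝ) → (Fin d → ℝ)}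
    (hH : IsHiddenStack σ K b d H) {f : (Fin a → ℝ) → (Fin b → ℝ)} (hf : IsDeepNet σ K a b f) :
    IsHiddenStack σ K a d (fun x => H (f x)) := by
  induction hH with
  | base hd A w =>
    obtain ⟨e, G, hG, B, v, rfl⟩ := hf
    convert IsHiddenStack.step hd hG (A * B) (A.mulVec v + w) using 3
    rw [← Matrix.mulVec_mulVec, Matrix.mulVec_sub]
    abel
  | step he _ A w ih => exact IsHiddenStack.step he ih A w

theorem IsDeepNet.comp {a b c : ℕ} {g : (Fin b → ℝ) → (Fin c → ℝ)} (hg : IsDeepNet σ K b c g)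
    {f : (Fin a → ℝ) → (Fin b → ℝ)} (hf : IsDeepNet σ K a b f) :
    IsDeepNet σ K a c (fun x => g (f x)) := by
  obtain ⟨d, H, hH, A, v, rfl⟩ := hg
  exact ⟨d, _, hH.comp_deepNet hf, A, v, rfl⟩

/-- A single layer in which every neuron `i` has its own affine pre- and postprocessing. -/
theorem isDeepNet_single_layer {k : ℕ} (hk : k ≤ K) (p q r s : Fin k → ℝ) :
    IsDeepNet σ K k k (fun z i => r i * σ (p i * z i + q i) + s i) := by
  refine ⟨k, _, IsHiddenStack.base hk (Matrix.diagonal p) (-q), Matrix.diagonal r, -s, ?_⟩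
  funext z i
  simp [applyAct, Matrix.mulVec_diagonal]

/-- The continuous maps that are limits, uniformly on compact sets, of networks of width at most
`K`. -/
def netClosure (σ : ℝ → ℝ) (K a b : ℕ) : Set C(Fin a → ℝ, Fin b → ℝ) :=
  closure {f | IsDeepNet σ K a b f}

theorem comp_mem_netClosure {a b c : ℕ} {g : C(Fin b → ℝ, Fin c → ℝ)}
    {f : C(Fin a → ℝ, Fin b → ℝ)} (hg : g ∈ netClosure σ K b c) (hf : f ∈ netClosure σ K a b) :
    g.comp f ∈ netClosure σ K a c :=
  map_mem_closure₂ (f := fun f g => g.comp f) ContinuousMap.continuous_comp' hf hg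
    fun _ hf _ hg => IsDeepNet.comp hg hf

theorem update_mem_netClosure (hσ : Continuous σ) {t₀ : ℝ} (hd : DifferentiableAt ℝ σ t₀)
    (hd0 : deriv σ t₀ ≠ 0) {k : ℕ} (hk : k ≤ K) (S : Fin k → Prop) [DecidablePred S]
    {f : C(Fin k → ℝ, Fin k → ℝ)} (hf : ∀ z i, f z i = if S i then σ (z i) else z i) :
    f ∈ netClosure σ K k k := by
  have hds := continuous_dslope hσ hd
  let c : ℝ → C(Fin k → ℝ, Fin k → ℝ) := fun h =>
    ⟨fun z i => if S i then σ (z i) else (deriv σ t₀)⁻¹ * (z i * dslope σ t₀ (t₀ + h * z i)), by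
      refine continuous_pi fun i => ?_
      split_ifs <;> fun_prop⟩
  have hc : Continuous c := by
    refine ContinuousMap.continuous_of_continuous_uncurry _ ?_
    refine continuous_pi fun i => ?_
    simp only [Function.uncurry, c, ContinuousMap.coe_mk]
    split_ifs <;> fun_prop
  have h0 : c 0 = f := by
    ext z i
    simp only [c, ContinuousMap.coe_mk, hf]
    split_ifs
    · rfl
    · simp [dslope_same]
      field_simp
  rw [← h0]
  refine isClosed_closure.mem_of_continuous_of_forall_ne hc fun h hh => subset_closure ?_
  have hch : ⇑(c h) = fun z i => (if S i then 1 else (h * deriv σ t₀)⁻¹) *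
      σ ((if S i then 1 else h) * z i + (if S i then 0 else t₀)) +
      (if S i then 0 else -((h * deriv σ t₀)⁻¹ * σ t₀)) := by
    funext z i
    simp only [c, ContinuousMap.coe_mk]
    split_ifs with hS
    · simp
    · rcases eq_or_ne (z i) 0 with hz | hz
      · simp [hz]
      · rw [dslope_of_ne _ (by simp [hh, hz]), slope_def_field, add_sub_cancel_left, add_comm t₀]
        field_simp
        ring
  change IsDeepNet σ K k k (c h)
  rw [hch]
  exact isDeepNet_single_layer hk _ _ _ _

theorem affine_mem_netClosure (hσ : Continuous σ) {t₀ : ℝ} (hd : DifferentiableAt ℝ σ t₀)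
    (hd0 : deriv σ t₀ ≠ 0) {k : ℕ} (hk : k ≤ K) (T : (Fin k → ℝ) →ₗ[ℝ] (Fin k → ℝ))
    (v : Fin k → ℝ) {f : C(Fin k → ℝ, Fin k → ℝ)} (hf : ∀ z, f z = T z + v) :
    f ∈ netClosure σ K k k := by
  have hid : ContinuousMap.id _ ∈ netClosure σ K k k :=
    update_mem_netClosure hσ hd hd0 hk (fun _ => False) (by simp)
  rw [← f.comp_id]
  refine map_mem_closure (ContinuousMap.continuous_postcomp f) hid fun g hg => ?_
  have := IsDeepNet.affine_comp hg T v
  simp only [← hf] at this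
  exact this

end Networks

/-! ### Univariate density -/

section Univariate

open MeasureTheory
open scoped ContDiff

theorem Submodule.integral_mem_of_isClosed {X E : Type*} [MeasurableSpace X] {μ : Measure X}
    [NormedAddCommGroup E] [NormedSpace ℝ E] [CompleteSpace E] {V : Submodule ℝ E}
    (hV : IsClosed (V : Set E)) {f : X → E} (hf : Integrable f μ) (hfV : ∀ x, f x ∈ V) :
    ∫ x, f x ∂μ ∈ V := by
  have := hV
  rw [← Submodule.Quotient.mk_eq_zero, ← Submodule.mkQ_apply, ← Submodule.mkQL_apply,
    ← ContinuousLinearMap.integral_comp_comm _ hf]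
  simp [(Submodule.Quotient.mk_eq_zero V).2 (hfV _)]

/-- A closed subspace of `C(ℝ, ℝ)` contains the integrals of compactly supported continuous curves
with values in it. -/
theorem mem_of_forall_eq_integral {V : Submodule ℝ C(ℝ, ℝ)} (hV : IsClosed (V : Set C(ℝ, ℝ)))
    {G : ℝ → C(ℝ, ℝ)} (hG : Continuous G) (hGc : HasCompactSupport G) (hGV : ∀ t, G t ∈ V)
    {F : C(ℝ, ℝ)} (hF : ∀ x, F x = ∫ t, G t x) : F ∈ V := by
  rw [← SetLike.mem_coe, ← hV.closure_eq, ContinuousMap.mem_closure_iff_forall_isCompact]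
  intro K hK ε hε
  have := isCompact_iff_compactSpace.mp hK
  let R : C(ℝ, ℝ) →L[ℝ] C(K, ℝ) :=
    { toFun := fun f => f.restrict K
      map_add' := fun _ _ => rfl
      map_smul' := fun _ _ => rfl
      cont := ContinuousMap.continuous_restrict K }
  have hint : Integrable (fun t => R (G t)) :=
    (R.continuous.comp hG).integrable_of_hasCompactSupport (hGc.comp_left (map_zero R))
  have hmem : ∫ t, R (G t) ∈ (V.map R.toLinearMap).topologicalClosure :=
    Submodule.integral_mem_of_isClosed (Submodule.isClosed_topologicalClosure _) hint
      fun t => Submodule.le_topologicalClosure _ (Submodule.mem_map_of_mem (hGV t))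
  obtain ⟨_, ⟨g, hg, rfl⟩, hlt⟩ := Metric.mem_closure_iff.1 hmem ε hε
  refine ⟨g, hg, fun x hx => ?_⟩
  rw [ContinuousMap.dist_lt_iff hε] at hlt
  have := hlt ⟨x, hx⟩
  rw [ContinuousMap.integral_apply hint] at this
  rw [hF]
  exact this

theorem iteratedDeriv_comp_affine_mul_pow_mem {V : Submodule ℝ C(ℝ, ℝ)}
    (hV : IsClosed (V : Set C(ℝ, ℝ))) {f : ℝ → ℝ} (hf : ContDiff ℝ ∞ f)
    (hfV : ∀ (w b : ℝ) (g : C(ℝ, ℝ)), (∀ x, g x = f (w * x + b)) → g ∈ V) (k : ℕ) :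
    ∀ (w b : ℝ) (g : C(ℝ, ℝ)), (∀ x, g x = x ^ k * iteratedDeriv k f (w * x + b)) → g ∈ V := by
  induction k with
  | zero => simpa using hfV
  | succ k ih =>
    intro w b g hg
    have hd : ∀ u, HasDerivAt (iteratedDeriv k f) (iteratedDeriv (k + 1) f u) u := fun u => by
      rw [iteratedDeriv_succ]
      exact (hf.differentiable_iteratedDeriv k
        (by exact_mod_cast WithTop.coe_lt_top k)).differentiableAt.hasDerivAt
    have hck : Continuous (iteratedDeriv k f) :=
      hf.continuous_iteratedDeriv k (by exact_mod_cast le_top)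
    have hck' : Continuous (iteratedDeriv (k + 1) f) :=
      hf.continuous_iteratedDeriv (k + 1) (by exact_mod_cast le_top)
    have hcont : Continuous fun p : ℝ × ℝ =>
        p.2 ^ (k + 1) *
          ∫ s in (0 : ℝ)..1, iteratedDeriv (k + 1) f (w * p.2 + b + s * (p.1 * p.2)) :=
      (by fun_prop : Continuous fun p : ℝ × ℝ => p.2 ^ (k + 1)).mul
        (intervalIntegral.continuous_parametric_intervalIntegral_of_continuous'
          (by simp only [Function.uncurry_def]; fun_prop) _ _)
    let c : C(ℝ, C(ℝ, ℝ)) := (⟨_, hcont⟩ : C(ℝ × ℝ, ℝ)).curry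
    have hc : ∀ h x, c h x = x ^ (k + 1) *
        ∫ s in (0 : ℝ)..1, iteratedDeriv (k + 1) f (w * x + b + s * (h * x)) := fun _ _ => rfl
    have h0 : c 0 = g := by
      ext x
      simp [hc, hg]
    rw [← h0, ← SetLike.mem_coe]
    refine hV.mem_of_continuous_of_forall_ne c.continuous fun h hh => ?_
    have hch : c h = h⁻¹ •
        ((⟨fun x => x ^ k * iteratedDeriv k f ((w + h) * x + b), by fun_prop⟩ : C(ℝ, ℝ)) -
          ⟨fun x => x ^ k * iteratedDeriv k f (w * x + b), by fun_prop⟩) := by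
      ext x
      have key := intervalIntegral.integral_unitInterval_deriv_eq_sub (𝕜 := ℝ)
        (f := iteratedDeriv k f)
        (z₀ := w * x + b) (z₁ := h * x) (by fun_prop) (fun t _ => hd _)
      simp only [smul_eq_mul] at key
      simp only [hc, ContinuousMap.smul_apply, ContinuousMap.sub_apply, ContinuousMap.coe_mk,
        smul_eq_mul]
      rw [show (w + h) * x + b = w * x + b + h * x by ring, ← mul_sub, ← key]
      generalize ∫ s in (0 : ℝ)..1, iteratedDeriv (k + 1) f (w * x + b + s * (h * x)) = I
      field_simp
      ring
    rw [hch]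
    exact V.smul_mem _ (V.sub_mem (ih _ _ _ fun _ => rfl) (ih _ _ _ fun _ => rfl))

/-- The functions `ℝ → ℝ` given by polynomials of degree less than `k`. -/
noncomputable def polyFun (k : ℕ) : Submodule ℝ (ℝ → ℝ) :=
  (Polynomial.degreeLT ℝ k).map
    (LinearMap.pi fun x => Polynomial.leval x : Polynomial ℝ →ₗ[ℝ] ℝ → ℝ)

theorem mem_polyFun {k : ℕ} {f : ℝ → ℝ} :
    f ∈ polyFun k ↔ ∃ p : Polynomial ℝ, p.degree < k ∧ ∀ x, f x = p.eval x := by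
  simp only [polyFun, Submodule.mem_map, Polynomial.mem_degreeLT]
  refine exists_congr fun p => and_congr_right fun _ => ?_
  rw [eq_comm, funext_iff]
  rfl

theorem isClosed_polyFun (k : ℕ) : IsClosed (polyFun k : Set (ℝ → ℝ)) := by
  have : FiniteDimensional ℝ (Polynomial.degreeLT ℝ k) :=
    (Polynomial.degreeLTEquiv ℝ k).symm.finiteDimensional
  have : FiniteDimensional ℝ (polyFun k) := by unfold polyFun; infer_instance
  exact Submodule.closed_of_finiteDimensional _

theorem exists_derivative_eq {k : ℕ} {p : Polynomial ℝ} (hp : p.degree < k) :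
    ∃ q : Polynomial ℝ, q.derivative = p ∧ q.degree < (k + 1 : ℕ) := by
  refine ⟨∑ i ∈ Finset.range k, Polynomial.monomial (i + 1) (p.coeff i / (i + 1)), ?_, ?_⟩
  · ext n
    simp only [Polynomial.coeff_derivative, Polynomial.finsetSum_coeff, Polynomial.coeff_monomial,
      add_left_inj, Finset.sum_ite_eq', Finset.mem_range]
    split_ifs with h
    · field_simp
    · rw [zero_mul, Polynomial.coeff_eq_zero_of_degree_lt
        (hp.trans_le (by exact_mod_cast not_lt.1 h))]
  · refine (Polynomial.degree_sum_le _ _).trans_lt ((Finset.sup_lt_iff (WithBot.bot_lt_coe _)).2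
      fun i hi => (Polynomial.degree_monomial_le _ _).trans_lt ?_)
    have := Finset.mem_range.1 hi
    exact_mod_cast Nat.succ_lt_succ this

theorem mem_polyFun_of_iteratedDeriv_eq_zero {k : ℕ} {f : ℝ → ℝ} (hf : ContDiff ℝ ∞ f)
    (h : ∀ x, iteratedDeriv k f x = 0) : f ∈ polyFun k := by
  induction k generalizing f with
  | zero =>
    exact mem_polyFun.2 ⟨0, by simp, by simpa using h⟩
  | succ k ih =>
    obtain ⟨p, hp, hfp⟩ := mem_polyFun.1 (ih (f := deriv f)
      ((contDiff_infty_iff_deriv.1 hf).2) (by simpa [iteratedDeriv_succ'] using h))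
    obtain ⟨q, rfl, hq⟩ := exists_derivative_eq hp
    have hconst := is_const_of_deriv_eq_zero (f := fun x => f x - q.eval x)
      ((hf.differentiable (by simp)).sub q.differentiable) (fun x => by
        rw [deriv_fun_sub (hf.differentiable (by simp) x) q.differentiableAt, hfp, q.deriv,
          sub_self])
    refine mem_polyFun.2 ⟨q + Polynomial.C (f 0 - q.eval 0), ?_, fun x => ?_⟩
    · refine (Polynomial.degree_add_le _ _).trans_lt (max_lt hq ?_)
      exact Polynomial.degree_C_le.trans_lt (by exact_mod_cast Nat.succ_pos k)
    · have := hconst x 0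
      simp only [Polynomial.eval_add, Polynomial.eval_C]
      linarith

theorem pow_mem_of_notMem_polyFun {V : Submodule ℝ C(ℝ, ℝ)} (hV : IsClosed (V : Set C(ℝ, ℝ)))
    {k : ℕ} {ρ : C(ℝ, ℝ)} (hρ : ⇑ρ ∉ polyFun k)
    (hρV : ∀ (w b : ℝ) (g : C(ℝ, ℝ)), (∀ x, g x = ρ (w * x + b)) → g ∈ V)
    {g : C(ℝ, ℝ)} (hg : ∀ x, g x = x ^ k) : g ∈ V := by
  let φ : ℕ → ContDiffBump (0 : ℝ) := fun j =>
    ⟨1 / (j + 2), 1 / (j + 1), by positivity, by gcongr; norm_num⟩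
  let F : ℕ → ℝ → ℝ := fun j =>
    convolution ((φ j).normed volume) ρ (ContinuousLinearMap.lsmul ℝ ℝ) volume
  have hF : ∀ j, ContDiff ℝ ∞ (F j) := fun j =>
    (φ j).hasCompactSupport_normed.contDiff_convolution_left _ (φ j).contDiff_normed
      ρ.continuous.locallyIntegrable
  obtain ⟨j, b, hb⟩ : ∃ j b, iteratedDeriv k (F j) b ≠ 0 := by
    by_contra! H
    refine hρ ((isClosed_polyFun k).mem_of_tendsto (f := F) (b := atTop) ?_
      (Eventually.of_forall fun j => mem_polyFun_of_iteratedDeriv_eq_zero (hF j) (H j)))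
    refine tendsto_pi_nhds.2 fun x => ContDiffBump.convolution_tendsto_right_of_continuous
      ?_ ρ.continuous x
    exact tendsto_one_div_add_atTop_nhds_zero_nat
  have hFV : ∀ (w b : ℝ) (g : C(ℝ, ℝ)), (∀ x, g x = F j (w * x + b)) → g ∈ V := by
    intro w b g hg
    let H : C(ℝ × ℝ, ℝ) := ⟨fun p => (φ j).normed volume p.1 * ρ (w * p.2 + b - p.1), by
      have := (φ j).continuous_normed (μ := volume)
      fun_prop⟩
    refine mem_of_forall_eq_integral hV H.curry.continuous ?_ (fun t => ?_) (F := g) fun x => ?_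
    · refine (φ j).hasCompactSupport_normed (μ := volume) |>.mono fun t ht h0 => ht ?_
      ext x
      simp [H, h0]
    · have : H.curry t = (φ j).normed volume t •
          (⟨fun x => ρ (w * x + (b - t)), by fun_prop⟩ : C(ℝ, ℝ)) := by
        ext x
        simp [H, add_sub_assoc]
      rw [this]
      exact V.smul_mem _ (hρV _ _ _ fun _ => rfl)
    · rw [hg]
      rfl
  have hm := iteratedDeriv_comp_affine_mul_pow_mem hV (hF j) hFV k 0 b
    (iteratedDeriv k (F j) b • g) fun x => by simp [hg, mul_comm]
  simpa [hb] using V.smul_mem (iteratedDeriv k (F j) b)⁻¹ hm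

theorem eq_top_of_forall_notMem_polyFun {V : Submodule ℝ C(ℝ, ℝ)}
    (hV : IsClosed (V : Set C(ℝ, ℝ)))
    (hρ : ∀ k, ∃ ρ : C(ℝ, ℝ), ⇑ρ ∉ polyFun k ∧
      ∀ (w b : ℝ) (g : C(ℝ, ℝ)), (∀ x, g x = ρ (w * x + b)) → g ∈ V) : V = ⊤ := by
  rw [eq_top_iff]
  intro f _
  rw [← SetLike.mem_coe, ← hV.closure_eq, ContinuousMap.mem_closure_iff_forall_isCompact]
  intro K hK ε hε
  have hsep :
      (Polynomial.toContinuousMapAlgHom : Polynomial ℝ →ₐ[ℝ] C(ℝ, ℝ)).range.SeparatesPoints :=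
    fun x y hxy => ⟨_, ⟨_, ⟨Polynomial.X, rfl⟩, rfl⟩, by simpa using hxy⟩
  obtain ⟨_, ⟨p, rfl⟩, hp⟩ :=
    ContinuousMap.exists_mem_subalgebra_near_continuous_of_isCompact_of_separatesPoints hsep f hK hε
  refine ⟨_, ?_, fun x hx => by rw [dist_comm, dist_eq_norm]; exact hp x hx⟩
  change Polynomial.toContinuousMapAlgHom p ∈ V
  clear hp
  induction p using Polynomial.induction_on' with
  | add p q hp hq =>
    rw [map_add]
    exact V.add_mem hp hq
  | monomial k a =>
    obtain ⟨ρ, hρ, hρV⟩ := hρ k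
    have := V.smul_mem a
      (pow_mem_of_notMem_polyFun hV hρ hρV (g := ⟨fun x => x ^ k, by fun_prop⟩) fun _ => rfl)
    convert this
    ext x
    simp

theorem iterate_notMem_polyFun {σ : ℝ → ℝ} (hσ : ¬ ∃ a b : ℝ, ∀ t, σ t = a * t + b) (k : ℕ) :
    ∃ j, σ^[j] ∉ polyFun k := by
  by_contra! H
  obtain ⟨p, -, hp⟩ := mem_polyFun.1 (H 1)
  obtain rfl : σ = fun x => p.eval x := funext hp
  have hdeg : 2 ≤ p.natDegree := by
    by_contra! h
    refine hσ ⟨p.coeff 1, p.coeff 0, fun t => ?_⟩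
    conv_lhs => rw [p.eq_X_add_C_of_natDegree_le_one (by omega)]
    simp
  obtain ⟨q, hq, hpq⟩ := mem_polyFun.1 (H k)
  obtain rfl : p.comp^[k] Polynomial.X = q := by
    refine Polynomial.funext fun x => ?_
    rw [← hpq, Polynomial.iterate_comp_eval, Polynomial.eval_X]
  have h1 : p.natDegree ^ k < k := by
    have := Polynomial.natDegree_iterate_comp (p := p) (q := Polynomial.X) k
    rw [Polynomial.natDegree_X, mul_one] at this
    rw [← this]
    exact (Polynomial.natDegree_lt_iff_degree_lt fun h => by
      rw [h, Polynomial.natDegree_zero] at this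
      exact absurd this (by positivity)).2 hq
  have h2 : k < p.natDegree ^ k := Nat.lt_pow_self hdeg
  omega

end Univariate

/-! ### Multivariate density -/

theorem eq_top_of_forall_exp_mem {n : ℕ} {W : Submodule ℝ C(Fin n → ℝ, ℝ)}
    (hW : IsClosed (W : Set C(Fin n → ℝ, ℝ)))
    (hexp : ∀ (l : (Fin n → ℝ) →L[ℝ] ℝ) (g : C(Fin n → ℝ, ℝ)),
      (∀ x, g x = Real.exp (l x)) → g ∈ W) :
    W = ⊤ := by
  rw [eq_top_iff]
  intro f _
  rw [← SetLike.mem_coe, ← hW.closure_eq, ContinuousMap.mem_closure_iff_forall_isCompact]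
  intro K hK ε hε
  let S : Submonoid C(Fin n → ℝ, ℝ) :=
    { carrier := {g | ∃ l : (Fin n → ℝ) →L[ℝ] ℝ, ∀ x, g x = Real.exp (l x)}
      one_mem' := ⟨0, by simp⟩
      mul_mem' := by
        rintro g h ⟨l, hl⟩ ⟨l', hl'⟩
        exact ⟨l + l', fun x => by simp [hl, hl', Real.exp_add]⟩ }
  have hsep : (Algebra.adjoin ℝ (S : Set C(Fin n → ℝ, ℝ))).SeparatesPoints := by
    intro x y hxy
    obtain ⟨i, hi⟩ := Function.ne_iff.1 hxy
    have hmem : (⟨fun x => Real.exp (x i), by fun_prop⟩ : C(Fin n → ℝ, ℝ)) ∈ S :=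
      ⟨ContinuousLinearMap.proj i, fun _ => rfl⟩
    exact ⟨_, ⟨_, Algebra.subset_adjoin hmem, rfl⟩, by simpa using hi⟩
  obtain ⟨g, hg, hlt⟩ :=
    ContinuousMap.exists_mem_subalgebra_near_continuous_of_isCompact_of_separatesPoints hsep f hK hε
  refine ⟨g, ?_, fun x hx => by rw [dist_comm, dist_eq_norm]; exact hlt x hx⟩
  rw [← Subalgebra.mem_toSubmodule, Algebra.adjoin_eq_span, Submonoid.closure_eq] at hg
  refine Submodule.span_le.2 (fun g hg => ?_) hg
  obtain ⟨l, hl⟩ := hg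
  exact hexp l g hl

/-! ### The register model -/

section Registers

variable {σ : ℝ → ℝ} {K n m : ℕ}

/-- The state of a register machine: input registers, output registers and one scratch register. -/
abbrev RegState (n m : ℕ) : Type := ((Fin n → ℝ) × (Fin m → ℝ)) × ℝ

theorem exists_regState_equiv (n m : ℕ) :
    ∃ L : RegState n m ≃L[ℝ] (Fin (n + m + 1) → ℝ),
      (∀ z, L z 0 = z.2) ∧ ∀ z s i, i ≠ 0 → L (z.1, s) i = L z i := by
  let e : ((Fin n → ℝ) × (Fin m → ℝ)) ≃L[ℝ] (Fin (n + m) → ℝ) :=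
    ContinuousLinearEquiv.ofFinrankEq (by simp)
  refine ⟨((e.prodCongr (ContinuousLinearEquiv.refl ℝ ℝ)).trans
    (ContinuousLinearEquiv.prodComm ℝ _ _)).trans (Fin.consEquivL ℝ fun _ => ℝ), fun z => ?_,
    fun z s i hi => ?_⟩
  · simp [Fin.consEquivL]
  · obtain ⟨i, rfl⟩ := Fin.exists_succ_eq.2 hi
    simp [Fin.consEquivL]

/-- The continuous maps of the register state that are implemented, in the limit, by networks of
width at most `K`, the state being encoded through `L`. -/
def regMaps (σ : ℝ → ℝ) (K : ℕ) (L : RegState n m ≃L[ℝ] (Fin (n + m + 1) → ℝ)) :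
    Set C(RegState n m, RegState n m) :=
  {f | ((L : C(RegState n m, Fin (n + m + 1) → ℝ)).comp f).comp
    (L.symm : C(Fin (n + m + 1) → ℝ, RegState n m)) ∈ netClosure σ K _ _}

variable {L : RegState n m ≃L[ℝ] (Fin (n + m + 1) → ℝ)}

theorem isClosed_regMaps : IsClosed (regMaps σ K L) :=
  isClosed_closure.preimage
    ((ContinuousMap.continuous_precomp _).comp (ContinuousMap.continuous_postcomp _))

theorem comp_mem_regMaps {f g : C(RegState n m, RegState n m)} (hg : g ∈ regMaps σ K L)
    (hf : f ∈ regMaps σ K L) : g.comp f ∈ regMaps σ K L := by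
  change _ ∈ netClosure σ K _ _
  convert comp_mem_netClosure hg hf using 1
  ext z
  simp

/-- The register machine can overwrite registers affinely and apply `σ` to its scratch register. -/
structure IsRegisterMachine (σ : ℝ → ℝ) (M : Set C(RegState n m, RegState n m)) : Prop where
  isClosed : IsClosed M
  comp_mem : ∀ {f g}, g ∈ M → f ∈ M → g.comp f ∈ M
  affine_mem : ∀ (T : RegState n m →ₗ[ℝ] RegState n m) (v : RegState n m)
    {f : C(RegState n m, RegState n m)}, (∀ z, f z = T z + v) → f ∈ M
  scratch_mem : ∀ {f : C(RegState n m, RegState n m)}, (∀ z, f z = (z.1, σ z.2)) → f ∈ M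

theorem isRegisterMachine_regMaps (hσ : Continuous σ) {t₀ : ℝ} (hd : DifferentiableAt ℝ σ t₀)
    (hd0 : deriv σ t₀ ≠ 0) (hK : n + m + 1 ≤ K) (hL : ∀ z, L z 0 = z.2)
    (hL' : ∀ z s i, i ≠ 0 → L (z.1, s) i = L z i) :
    IsRegisterMachine σ (regMaps σ K L) where
  isClosed := isClosed_regMaps
  comp_mem := comp_mem_regMaps
  affine_mem T v f hf :=
    affine_mem_netClosure hσ hd hd0 hK
      ((L.toLinearEquiv.toLinearMap ∘ₗ T) ∘ₗ L.symm.toLinearEquiv.toLinearMap) (L v)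
      fun z => by simp [hf]
  scratch_mem {f} hf := by
    refine update_mem_netClosure hσ hd hd0 hK (fun i => i = 0) fun z i => ?_
    have hz : (L.symm z).2 = z 0 := by rw [← hL, L.apply_symm_apply]
    by_cases hi : i = 0
    · simp [hi, hL, hf, hz]
    · simp [hi, hf, hL' (L.symm z) _ i hi]

/-- Add the value of `ψ` at the input registers, times `c`, to the output registers, and clear the
scratch register. -/
def addStep (c : Fin m → ℝ) (ψ : C(Fin n → ℝ, ℝ)) : C(RegState n m, RegState n m) :=
  ⟨fun z => ((z.1.1, z.1.2 + ψ z.1.1 • c), 0), by fun_prop⟩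

theorem continuous_addStep (c : Fin m → ℝ) : Continuous (addStep (n := n) c) := by
  refine ContinuousMap.continuous_of_continuous_uncurry _ ?_
  have : Continuous fun p : C(Fin n → ℝ, ℝ) × RegState n m => p.1 p.2.1.1 := by fun_prop
  simp only [Function.uncurry_def, addStep, ContinuousMap.coe_mk]
  fun_prop

variable {M : Set C(RegState n m, RegState n m)}

/-- The functions of the input registers that can be added to the output registers. -/
def IsRegisterMachine.addable (hM : IsRegisterMachine σ M) : Submodule ℝ C(Fin n → ℝ, ℝ) where
  carrier := {ψ | ∀ c, addStep c ψ ∈ M}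
  zero_mem' c := hM.affine_mem
    ((LinearMap.inl ℝ ((Fin n → ℝ) × (Fin m → ℝ)) ℝ) ∘ₗ LinearMap.fst ℝ _ _) 0
    fun z => by simp [addStep]
  add_mem' {φ ψ} hφ hψ c := by
    convert hM.comp_mem (hφ c) (hψ c) using 1
    ext z <;> simp [addStep]
    ring
  smul_mem' a ψ hψ c := by
    convert hψ (a • c) using 1
    ext z <;> simp [addStep]
    ring

theorem IsRegisterMachine.isClosed_addable (hM : IsRegisterMachine σ M) :
    IsClosed (hM.addable : Set C(Fin n → ℝ, ℝ)) := by
  have : (hM.addable : Set C(Fin n → ℝ, ℝ)) = ⋂ c, addStep c ⁻¹' M := by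
    ext ψ
    simp [addable]
  rw [this]
  exact isClosed_iInter fun c => hM.isClosed.preimage (continuous_addStep c)

theorem IsRegisterMachine.iterate_mem_addable (hM : IsRegisterMachine σ M) (hσ : Continuous σ)
    (j : ℕ) (l : (Fin n → ℝ) →ₗ[ℝ] ℝ) (b : ℝ) {ψ : C(Fin n → ℝ, ℝ)}
    (hψ : ∀ x, ψ x = σ^[j] (l x + b)) : ψ ∈ hM.addable := by
  intro c
  let fst := LinearMap.fst ℝ ((Fin n → ℝ) × (Fin m → ℝ)) ℝ
  have hl : Continuous l := l.continuous_of_finiteDimensional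
  let load : C(RegState n m, RegState n m) := ⟨fun z => (z.1, l z.1.1 + b), by fun_prop⟩
  have hload : load ∈ M :=
    hM.affine_mem (LinearMap.prod fst (l ∘ₗ LinearMap.fst ℝ _ _ ∘ₗ fst)) (0, b) fun z => by
      simp [load, fst]
  let iter : ℕ → C(RegState n m, RegState n m) := fun j =>
    ⟨fun z => (z.1, σ^[j] z.2), by have := hσ.iterate j; fun_prop⟩
  have hiter : ∀ j, iter j ∈ M := fun j => by
    induction j with
    | zero => exact hM.affine_mem LinearMap.id 0 fun z => by simp [iter]
    | succ j ih =>
      have h1 : iter 1 ∈ M := hM.scratch_mem fun z => rfl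
      convert hM.comp_mem h1 ih using 1
      ext z <;> simp [iter, Function.iterate_succ_apply']
  let store : C(RegState n m, RegState n m) :=
    ⟨fun z => ((z.1.1, z.1.2 + z.2 • c), 0), by fun_prop⟩
  have hstore : store ∈ M :=
    hM.affine_mem (LinearMap.prod (LinearMap.prod (LinearMap.fst ℝ _ _ ∘ₗ fst)
      (LinearMap.snd ℝ _ _ ∘ₗ fst + (LinearMap.snd ℝ _ _).smulRight c)) 0) 0 fun z => by
        simp [store, fst]
  convert hM.comp_mem hstore (hM.comp_mem (hiter j) hload) using 1
  ext z <;> simp [store, iter, load, addStep, hψ]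

theorem IsRegisterMachine.addable_eq_top (hM : IsRegisterMachine σ M) (hσ : Continuous σ)
    (hna : ¬ ∃ a b : ℝ, ∀ t, σ t = a * t + b) : hM.addable = ⊤ := by
  refine eq_top_of_forall_exp_mem hM.isClosed_addable fun l g hg => ?_
  let R : C(ℝ, ℝ) →ₗ[ℝ] C(Fin n → ℝ, ℝ) :=
    { toFun := fun ρ => ρ.comp (l : C(Fin n → ℝ, ℝ))
      map_add' := fun _ _ => rfl
      map_smul' := fun _ _ => rfl }
  have hR : Continuous R := ContinuousMap.continuous_precomp _
  have htop : hM.addable.comap R = ⊤ := by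
    refine eq_top_of_forall_notMem_polyFun (hM.isClosed_addable.preimage hR) fun k => ?_
    obtain ⟨j, hj⟩ := iterate_notMem_polyFun hna k
    refine ⟨⟨σ^[j], hσ.iterate j⟩, hj, fun w b g hg => ?_⟩
    exact hM.iterate_mem_addable hσ j (w • l.toLinearMap) b fun x => by simp [R, hg]
  have hmem : (⟨Real.exp, Real.continuous_exp⟩ : C(ℝ, ℝ)) ∈ hM.addable.comap R :=
    htop ▸ Submodule.mem_top
  convert Submodule.mem_comap.1 hmem using 1
  ext x
  simp [R, hg]

theorem IsRegisterMachine.add_mem (hM : IsRegisterMachine σ M) (hσ : Continuous σ)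
    (hna : ¬ ∃ a b : ℝ, ∀ t, σ t = a * t + b) (u : C(Fin n → ℝ, Fin m → ℝ))
    {f : C(RegState n m, RegState n m)} (hf : ∀ z, f z = ((z.1.1, z.1.2 + u z.1.1), 0)) :
    f ∈ M := by
  suffices H : ∀ s : Finset (Fin m),
      (⟨fun z => ((z.1.1, z.1.2 + ∑ i ∈ s, u z.1.1 i • Pi.single i 1), 0),
        by fun_prop⟩ : C(RegState n m, RegState n m)) ∈ M by
    convert H Finset.univ using 1
    ext z <;> simp [hf, Finset.sum_apply, Pi.single_apply]
  intro s
  induction s using Finset.induction_on with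
  | empty =>
    convert hM.addable.zero_mem 0 using 1
    ext z <;> simp [addStep]
  | insert i s hi ih =>
    have hmem : (⟨fun x => u x i, by fun_prop⟩ : C(Fin n → ℝ, ℝ)) ∈ hM.addable :=
      hM.addable_eq_top hσ hna ▸ Submodule.mem_top
    convert hM.comp_mem (hmem (Pi.single i 1)) ih using 1
    ext z <;> simp [addStep, Finset.sum_insert hi]
    ring

end Registers

/-- Deep networks of width `n + m + 1` are dense in `C(ℝⁿ, ℝᵐ)`. -/
theorem netClosure_eq_univ {σ : ℝ → ℝ} (hσ : Continuous σ) {t₀ : ℝ}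
    (hd : DifferentiableAt ℝ σ t₀) (hd0 : deriv σ t₀ ≠ 0)
    (hna : ¬ ∃ a b : ℝ, ∀ t, σ t = a * t + b) {n m K : ℕ} (hK : n + m + 1 ≤ K)
    (u : C(Fin n → ℝ, Fin m → ℝ)) : u ∈ netClosure σ K n m := by
  obtain ⟨L, hL, hL'⟩ := exists_regState_equiv n m
  let f : C(RegState n m, RegState n m) :=
    ⟨fun z => ((z.1.1, z.1.2 + u z.1.1), 0), by fun_prop⟩
  have hf : f ∈ regMaps σ K L :=
    (isRegisterMachine_regMaps hσ hd hd0 hK hL hL').add_mem hσ hna u fun _ => rfl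
  let J : (Fin n → ℝ) →ₗ[ℝ] (Fin (n + m + 1) → ℝ) :=
    L.toLinearEquiv.toLinearMap ∘ₗ LinearMap.inl ℝ _ ℝ ∘ₗ LinearMap.inl ℝ _ (Fin m → ℝ)
  let P : (Fin (n + m + 1) → ℝ) →ₗ[ℝ] (Fin m → ℝ) :=
    LinearMap.snd ℝ (Fin n → ℝ) _ ∘ₗ LinearMap.fst ℝ _ ℝ ∘ₗ L.symm.toLinearEquiv.toLinearMap
  let Jc : C(Fin n → ℝ, Fin (n + m + 1) → ℝ) := ⟨J, J.continuous_of_finiteDimensional⟩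
  let Pc : C(Fin (n + m + 1) → ℝ, Fin m → ℝ) := ⟨P, P.continuous_of_finiteDimensional⟩
  have hmem := map_mem_closure (f := fun g => (Pc.comp g).comp Jc)
    ((ContinuousMap.continuous_precomp Jc).comp (ContinuousMap.continuous_postcomp Pc)) hf
    (t := {f | IsDeepNet σ K n m f}) fun g hg => by
      have := (IsDeepNet.comp_affine hg J 0).affine_comp P 0
      simp only [add_zero] at this
      exact this
  have hu : u = (Pc.comp (((L : C(RegState n m, Fin (n + m + 1) → ℝ)).comp f).comp
      (L.symm : C(Fin (n + m + 1) → ℝ, RegState n m)))).comp Jc := by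
    ext x
    simp [Pc, Jc, P, J, f]
  rw [hu]
  exact hmem

theorem stmt8 {X : Type*} [TopologicalSpace X]
    (K : Set X) (hK : IsCompact K)
    (m : ℕ) (hm : 1 ≤ m) (n : ℕ)
    (F : X → (Fin n → ℝ)) (hF : Continuous F)
    (hdense : ∀ g : C(K, EuclideanSpace ℝ (Fin m)), ∀ ε : ℝ, 0 < ε →
      ∃ u : (Fin n → ℝ) → EuclideanSpace ℝ (Fin m), Continuous u ∧
        ∀ x : K, ‖g x - u (F (x : X))‖ < ε)
    (σ : ℝ → ℝ) (hσc : Continuous σ)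
    (hσna : ¬ ∃ a b : ℝ, ∀ t, σ t = a * t + b)
    (hσd : ∃ (t₀ : ℝ) (U : Set ℝ), IsOpen U ∧ t₀ ∈ U ∧
      (∀ t ∈ U, DifferentiableAt ℝ σ t) ∧ ContinuousAt (deriv σ) t₀ ∧ deriv σ t₀ ≠ 0)
    (g : C(K, EuclideanSpace ℝ (Fin m))) (ε : ℝ) (hε : 0 < ε) :
    ∃ Φ : (Fin n → ℝ) → (Fin m → ℝ),
      IsDeepNet σ (n + m + 2) n m Φ ∧
      ∀ x : K,
        ‖g x - (EuclideanSpace.equiv (Fin m) ℝ).symm (Φ (F (x : X)))‖ < ε := by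
  obtain ⟨t₀, U, -, ht₀, hd, -, hd0⟩ := hσd
  obtain ⟨u, hu, hgu⟩ := hdense g (ε / 2) (half_pos hε)
  let e := EuclideanSpace.equiv (Fin m) ℝ
  have hmem : (⟨fun x => e (u x), by fun_prop⟩ : C(Fin n → ℝ, Fin m → ℝ)) ∈
      netClosure σ (n + m + 2) n m :=
    netClosure_eq_univ hσc (hd t₀ ht₀) hd0 hσna (by omega) _
  have hmem' := image_closure_subset_closure_image (ContinuousMap.continuous_postcomp
    (e.symm : C(Fin m → ℝ, EuclideanSpace ℝ (Fin m)))) (mem_image_of_mem _ hmem)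
  obtain ⟨_, ⟨Φ, hΦ, rfl⟩, hlt⟩ := ContinuousMap.mem_closure_iff_forall_isCompact.1 hmem'
    (F '' K) (hK.image hF) (ε / 2) (half_pos hε)
  refine ⟨Φ, hΦ, fun x => ?_⟩
  have h := hlt (F x) (mem_image_of_mem F x.2)
  rw [dist_eq_norm] at h
  have h' : ‖u (F x) - e.symm (Φ (F x))‖ < ε / 2 := by simpa using h
  calc _ = ‖(g x - u (F x)) + (u (F x) - e.symm (Φ (F x)))‖ := by rw [sub_add_sub_cancel]
    _ < ε := (norm_add_le _ _).trans_lt (by linarith [hgu x])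
end

section
/- Let X be a Hausdorff topological space, let K ⊆ X be compact, let m ≥ 1 be an integer, and let F : X → ℝ^n be a continuous map. If the set {u ∘ F|_K : u ∈ C(ℝ^n;ℝ^m)} is dense in C(K;ℝ^m) with respect to the uniform norm on K, then the finite-dimensional composition property holds in the strong (exact) form on K: for every continuous function g : K → ℝ^m there exists a continuous function u : ℝ^n → ℝ^m such that g(x) = u(F(x)) for all x ∈ K. -/
open scoped BigOperators

theorem stmt11 {X : Type*} [TopologicalSpace X] [T2Space X]
    (K : Set X) (hK : IsCompact K)
    (m : ℕ) (hm : 1 ≤ m) (n : ℕ)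
    (F : X → (Fin n → ℝ)) (hF : Continuous F)
    (hdense : ∀ g : C(K, EuclideanSpace ℝ (Fin m)), ∀ ε : ℝ, 0 < ε →
      ∃ u : (Fin n → ℝ) → EuclideanSpace ℝ (Fin m), Continuous u ∧
        ∀ x : K, ‖g x - u (F (x : X))‖ < ε) :
    ∀ g : C(K, EuclideanSpace ℝ (Fin m)),
      ∃ u : (Fin n → ℝ) → EuclideanSpace ℝ (Fin m),
        Continuous u ∧ ∀ x : K, g x = u (F (x : X)) := by
  intro g
  have : CompactSpace K := isCompact_iff_compactSpace.mp hK
  have hf : Continuous fun x : K => F x := hF.comp continuous_subtype_val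
  have hquot : Topology.IsQuotientMap (Set.rangeFactorization fun x : K => F x) :=
    (hf.subtype_mk _).isClosedMap.isQuotientMap (hf.subtype_mk _)
      Set.rangeFactorization_surjective
  have hfactor : Function.FactorsThrough g (Set.rangeFactorization fun x : K => F x) := by
    intro x y hxy
    have hFxy : F x = F y := congrArg Subtype.val hxy
    refine eq_of_forall_dist_le fun ε hε => ?_
    obtain ⟨u, -, hu⟩ := hdense g (ε / 2) (half_pos hε)
    have hx := hu x
    have hy := hu y
    rw [← hFxy] at hy
    rw [← dist_eq_norm] at hx hy
    linarith [dist_triangle_right (g x) (g y) (u (F x))]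
  have : TietzeExtension (EuclideanSpace ℝ (Fin m)) := TietzeExtension.of_tvs ℝ
  have hclosed : IsClosed (Set.range fun x : K => F x) := (isCompact_range hf).isClosed
  let φ : C(K, Set.range fun x : K => F x) := ⟨_, hquot.continuous⟩
  obtain ⟨u, hu⟩ := ContinuousMap.exists_restrict_eq hclosed
    (Topology.IsQuotientMap.lift (f := φ) hquot g hfactor)
  refine ⟨u, u.continuous, fun x => ?_⟩
  have h₁ := DFunLike.congr_fun (Topology.IsQuotientMap.lift_comp (f := φ) hquot g hfactor) x
  have h₂ := DFunLike.congr_fun hu (φ x)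
  exact h₁.symm.trans h₂.symm
end
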